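/- arXiv:2403.15749 — 8 statements merged into one kernel-verified Lean document; each statement's English description precedes it below -/
import Mathlib

section
/- Let E be a real inner product space, f : E → ℝ, x ∈ E, and let g ∈ E, g ≠ 0, satisfy the subgradient inequality f(z) ≥ f(x) + ⟪g, z − x⟫ for all z ∈ E. Set u = ‖g‖⁻¹ • g and let r(t) = x − t•u for t ≥ 0. Then the ray r supports the lower level set of f at x: for every z with f(z) ≤ f(x), one has ⟪u, z − x⟫ ≤ 0, and hence ⨅_{t≥0} (‖z − r(t)‖ − t) ≤ 0. That is, {z : f(z) ≤ f(x)} is contained in the horoball {z : b_r(z) ≤ 0}. -/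
open scoped RealInnerProductSpace

/-- The half-space `{z : ⟪u, z - x⟫ ≤ 0}` lies in the horoball at level `0` of the ray
`t ↦ x - t • u`, for a unit vector `u`. -/
theorem iInf_norm_sub_ray_sub_nonpos {E : Type*} [NormedAddCommGroup E]
    [InnerProductSpace ℝ E] {u x z : E} (hu : ‖u‖ = 1) (h : ⟪u, z - x⟫ ≤ 0) :
    (⨅ t : NNReal, (‖z - (x - (t : ℝ) • u)‖ - (t : ℝ))) ≤ 0 := by
  have key (t : NNReal) : z - (x - (t : ℝ) • u) = (z - x) + (t : ℝ) • u := by abel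
  have norm_smul_u (t : NNReal) : ‖(t : ℝ) • u‖ = t := by simp [norm_smul, hu]
  have bdd : BddBelow (Set.range fun t : NNReal ↦ ‖z - (x - (t : ℝ) • u)‖ - (t : ℝ)) := by
    refine ⟨-‖z - x‖, ?_⟩
    rintro _ ⟨t, rfl⟩
    have ht := norm_sub_le ((z - x) + (t : ℝ) • u) (z - x)
    rw [add_sub_cancel_left, norm_smul_u] at ht
    simp only [key]
    linarith
  refine le_of_forall_pos_le_add fun ε hε ↦ ?_
  let t : NNReal := ⟨‖z - x‖ ^ 2 / (2 * ε), by positivity⟩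
  refine (ciInf_le bdd t).trans ?_
  have ht : 2 * (t : ℝ) * ε = ‖z - x‖ ^ 2 := by
    change 2 * (‖z - x‖ ^ 2 / (2 * ε)) * ε = _
    field_simp
  have hsq : ‖(z - x) + (t : ℝ) • u‖ ^ 2 ≤ ((t : ℝ) + ε) ^ 2 := by
    rw [norm_add_sq_real, norm_smul_u, real_inner_smul_right, real_inner_comm]
    nlinarith [mul_nonpos_of_nonneg_of_nonpos t.coe_nonneg h, sq_nonneg ε]
  have hle := le_of_abs_le (abs_le_of_sq_le_sq hsq (add_nonneg t.coe_nonneg hε.le))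
  rw [key]
  linarith

/-- If `g` is a nonzero subgradient of `f` at `x`, then the ray
`r t = x - t • (‖g‖⁻¹ • g)` supports the lower level set of `f` at `x`:
every `z` with `f z ≤ f x` lies in the horoball `{z : b_r z ≤ 0}`. -/
theorem subgradient_supports_levelSet {E : Type*} [NormedAddCommGroup E]
    [InnerProductSpace ℝ E] (f : E → ℝ) (x g : E) (hg : g ≠ 0)
    (hsub : ∀ z : E, f x + ⟪g, z - x⟫ ≤ f z) :
    ∀ z : E, f z ≤ f x →
      ⟪‖g‖⁻¹ • g, z - x⟫ ≤ 0 ∧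
      (⨅ t : NNReal, (‖z - (x - (t : ℝ) • (‖g‖⁻¹ • g))‖ - (t : ℝ))) ≤ 0 := by
  intro z hz
  have hinner : ⟪‖g‖⁻¹ • g, z - x⟫ ≤ 0 := by
    rw [real_inner_smul_left]
    exact mul_nonpos_of_nonneg_of_nonpos (by positivity) (by linarith [hsub z])
  have hu : ‖‖g‖⁻¹ • g‖ = 1 := by
    rw [norm_smul, norm_inv, norm_norm, inv_mul_cancel₀ (norm_ne_zero_iff.mpr hg)]
  exact ⟨hinner, iInf_norm_sub_ray_sub_nonpos hu hinner⟩
end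

section
/- Let M be a metric space, Ψ a nonempty type, a : Ψ → M, β : Ψ → ℝ with β ≥ 0, γ : Ψ → ℝ, and suppose f : M → ℝ satisfies f(z) ≥ β(ψ)·dist(z, a(ψ)) + γ(ψ) for all z ∈ M and ψ ∈ Ψ. Let x ∈ M and suppose ψ₀ ∈ Ψ attains the value at x: f(x) = β(ψ₀)·dist(x, a(ψ₀)) + γ(ψ₀), with β(ψ₀) > 0. Then: (i) every z ∈ M with f(z) ≤ f(x) satisfies dist(z, a(ψ₀)) ≤ dist(x, a(ψ₀)); and (ii) if r : ℝ≥0 → M is any geodesic ray with r(0) = x and r(s₀) = a(ψ₀) for some s₀ ≥ 0, then every z with f(z) ≤ f(x) satisfies ⨅_{t≥0} (dist(z, r(t)) − t) ≤ dist(z, a(ψ₀)) − dist(x, a(ψ₀)) ≤ 0; that is, r supports the lower level set {z : f(z) ≤ f(x)} at x. -/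
/-- The function `t ↦ dist z (r t) - t`, whose infimum is the Busemann function of the
geodesic ray `r` at `z`, is bounded below. -/
theorem bddBelow_dist_ray_sub {M : Type*} [PseudoMetricSpace M] {r : NNReal → M}
    (hr : ∀ s t : NNReal, dist (r s) (r t) = |(s : ℝ) - (t : ℝ)|) (z : M) :
    BddBelow (Set.range fun t : NNReal => dist z (r t) - (t : ℝ)) := by
  refine ⟨-dist z (r 0), ?_⟩
  rintro _ ⟨t, rfl⟩
  have h : dist (r 0) (r t) = t := by simp [hr]
  have := dist_triangle_left (r 0) (r t) z
  dsimp only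
  linarith

/-- For a distance envelope attaining its value at `x` with positive slope
`β ψ₀ > 0`: (i) the lower level set at `x` is contained in the ball around the
center `a ψ₀` through `x`; (ii) any geodesic ray starting at `x` and passing
through `a ψ₀` supports the lower level set at `x`. -/
theorem distanceEnvelope_ray_supports {M : Type*} [MetricSpace M]
    {Ψ : Type*} [Nonempty Ψ] (a : Ψ → M) (β γ : Ψ → ℝ) (f : M → ℝ)
    (hβ : ∀ ψ, 0 ≤ β ψ)
    (hmaj : ∀ (z : M) (ψ : Ψ), β ψ * dist z (a ψ) + γ ψ ≤ f z)
    (x : M) (ψ₀ : Ψ) (hx : f x = β ψ₀ * dist x (a ψ₀) + γ ψ₀)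
    (h0 : 0 < β ψ₀) :
    (∀ z : M, f z ≤ f x → dist z (a ψ₀) ≤ dist x (a ψ₀)) ∧
    (∀ r : NNReal → M, (∀ s t : NNReal, dist (r s) (r t) = |(s : ℝ) - (t : ℝ)|) →
      r 0 = x → ∀ s₀ : NNReal, r s₀ = a ψ₀ →
      ∀ z : M, f z ≤ f x →
        (⨅ t : NNReal, (dist z (r t) - (t : ℝ))) ≤ dist z (a ψ₀) - dist x (a ψ₀) ∧
        dist z (a ψ₀) - dist x (a ψ₀) ≤ 0) := by
  have hball : ∀ z : M, f z ≤ f x → dist z (a ψ₀) ≤ dist x (a ψ₀) := fun z hz =>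
    le_of_mul_le_mul_left (by linarith [hmaj z ψ₀]) h0
  refine ⟨hball, fun r hr hr0 s₀ hs z hz => ⟨?_, sub_nonpos.2 (hball z hz)⟩⟩
  have hd : dist x (a ψ₀) = s₀ := by simp [← hr0, ← hs, hr]
  simpa only [hs, hd] using ciInf_le (bddBelow_dist_ray_sub hr z) s₀
end

section
/- Let E be a real inner product space, L > 0, and let f : E → ℝ be L-Lipschitz. Let x ∈ E and let u ∈ E with ‖u‖ = 1 satisfy the support condition: for every z ∈ E with f(z) ≤ f(x), ⟪u, z − x⟫ ≤ 0. Then for every y ∈ E with ⟪u, y − x⟫ ≤ 0, one has f(x) − f(y) ≤ −L·⟪u, y − x⟫. -/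
open scoped RealInnerProductSpace

/-- If `f` is `L`-Lipschitz and the unit vector `u` supports the lower level set
of `f` at `x`, then for every `y` in the supporting halfspace,
`f x - f y ≤ -L * ⟪u, y - x⟫`. -/
theorem support_lipschitz_bound {E : Type*} [NormedAddCommGroup E]
    [InnerProductSpace ℝ E] (L : ℝ) (hL : 0 < L) (f : E → ℝ)
    (hf : ∀ z w : E, |f z - f w| ≤ L * ‖z - w‖)
    (x u : E) (hu : ‖u‖ = 1)
    (hsupp : ∀ z : E, f z ≤ f x → ⟪u, z - x⟫ ≤ 0) :
    ∀ y : E, ⟪u, y - x⟫ ≤ 0 → f x - f y ≤ -L * ⟪u, y - x⟫ := by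
  intro y hy
  refine le_of_forall_pos_le_add fun ε hε => ?_
  have hδ : 0 < ε / L := div_pos hε hL
  set t : ℝ := -⟪u, y - x⟫ + ε / L with ht
  have hinner : ⟪u, y + t • u - x⟫ = ε / L := by
    rw [add_sub_right_comm, inner_add_right, inner_smul_right, real_inner_self_eq_norm_sq, hu, ht]
    ring
  have hlt : f x < f (y + t • u) := by
    by_contra! h
    linarith [hsupp _ h]
  have hlip := (le_abs_self _).trans (hf (y + t • u) y)
  rw [add_sub_cancel_left, norm_smul, hu, mul_one, Real.norm_of_nonneg (by linarith)] at hlip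
  have hLt : L * t = -L * ⟪u, y - x⟫ + ε := by
    rw [ht]
    field_simp
  linarith
end

section
/- Let E be a real inner product space, L > 0, and let f : E → ℝ be L-Lipschitz. Let x, x* ∈ E with f(x*) ≤ f(x), let u ∈ E with ‖u‖ = 1 satisfy the support condition that every z with f(z) ≤ f(x) has ⟪u, z − x⟫ ≤ 0, and let ε > 0. Then the step x_ε = x − ε•u satisfies ‖x_ε − x*‖² ≤ ‖x − x*‖² + ε² − (2ε/L)·(f(x) − f(x*)). -/
open scoped RealInnerProductSpace

/-- One step of the horospherical subgradient method in a real inner product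
space: the step `x_ε = x - ε • u` along a supporting unit vector `u` satisfies
`‖x_ε - x*‖² ≤ ‖x - x*‖² + ε² - (2ε/L)(f x - f x*)`. -/
theorem subgradient_step_estimate {E : Type*} [NormedAddCommGroup E]
    [InnerProductSpace ℝ E] (L : ℝ) (hL : 0 < L) (f : E → ℝ)
    (hf : ∀ z w : E, |f z - f w| ≤ L * ‖z - w‖)
    (x xstar u : E) (hstar : f xstar ≤ f x) (hu : ‖u‖ = 1)
    (hsupp : ∀ z : E, f z ≤ f x → ⟪u, z - x⟫ ≤ 0)
    (ε : ℝ) (hε : 0 < ε) :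
    ‖(x - ε • u) - xstar‖ ^ 2
      ≤ ‖x - xstar‖ ^ 2 + ε ^ 2 - (2 * ε / L) * (f x - f xstar) := by
  set r := (f x - f xstar) / L with hr
  have hr0 : 0 ≤ r := div_nonneg (sub_nonneg.2 hstar) hL.le
  have hLr : L * r = f x - f xstar := mul_div_cancel₀ _ hL.ne'
  have hz : f (xstar + r • u) ≤ f x := by
    have h := (le_abs_self _).trans (hf (xstar + r • u) xstar)
    rw [add_sub_cancel_left, norm_smul, hu, mul_one, Real.norm_of_nonneg hr0, hLr] at h
    linarith
  have hin : r ≤ ⟪x - xstar, u⟫ := by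
    have h := hsupp _ hz
    have hsplit : xstar + r • u - x = r • u - (x - xstar) := by abel
    rw [hsplit, inner_sub_right, real_inner_smul_right, real_inner_self_eq_norm_sq, hu,
      real_inner_comm] at h
    linarith
  have hnorm : ‖(x - ε • u) - xstar‖ ^ 2
      = ‖x - xstar‖ ^ 2 - 2 * (ε * ⟪x - xstar, u⟫) + ε ^ 2 := by
    rw [sub_right_comm, norm_sub_sq_real, real_inner_smul_right, norm_smul, hu, mul_one,
      Real.norm_of_nonneg hε.le]
  have hgap : (2 * ε / L) * (f x - f xstar) = 2 * (ε * r) := by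
    rw [hr]; ring
  rw [hnorm, hgap]
  linarith [mul_le_mul_of_nonneg_left hin hε.le]
end

section
/- (Hilbert-space case of the main complexity theorem.) Let E be a real Hilbert space, X ⊆ E a nonempty closed convex set whose diameter is at most D, with D > 0, and let f : E → ℝ be L-Lipschitz with L > 0. Let x* ∈ X satisfy f(x*) ≤ f(y) for all y ∈ X. Fix an integer n > 0 and set ε = D/√n. Let x : ℕ → E be a sequence with x 0 ∈ X such that for each i < n there is a unit vector u i ∈ E with the support property — every z ∈ E with f(z) ≤ f(x i) satisfies ⟪u i, z − x i⟫ ≤ 0 — and x (i+1) is the metric projection of x i − ε•(u i) onto X, i.e. x (i+1) ∈ X and ‖x (i+1) − (x i − ε•(u i))‖ ≤ ‖y − (x i − ε•(u i))‖ for all y ∈ X. Then the average of the first n function values satisfies (1/n)·Σ_{i=0}^{n−1} f(x i) ≤ f(x*) + L·D/√n. -/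
open scoped RealInnerProductSpace

/-- The inner product characterisation of a nearest point of a convex set. -/
lemma inner_sub_nearest_point_nonpos {E : Type*} [NormedAddCommGroup E]
    [InnerProductSpace ℝ E] {X : Set E} (hconv : Convex ℝ X) {w p : E} (hp : p ∈ X)
    (hmin : ∀ y ∈ X, ‖p - w‖ ≤ ‖y - w‖) {y : E} (hy : y ∈ X) : ⟪w - p, y - p⟫ ≤ 0 := by
  have : Nonempty X := ⟨⟨p, hp⟩⟩
  refine (norm_eq_iInf_iff_real_inner_le_zero hconv hp).1 (le_antisymm ?_ ?_) y hy
  · refine le_ciInf fun z => ?_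
    rw [norm_sub_rev w p, norm_sub_rev w z]
    exact hmin z z.2
  · exact ciInf_le ⟨0, Set.forall_mem_range.2 fun z : X => norm_nonneg (w - (z : E))⟩
      (⟨p, hp⟩ : X)

/-- Projecting onto a convex set does not increase the distance to its points. -/
lemma norm_nearest_point_sub_sq_le {E : Type*} [NormedAddCommGroup E]
    [InnerProductSpace ℝ E] {X : Set E} (hconv : Convex ℝ X) {w p : E} (hp : p ∈ X)
    (hmin : ∀ y ∈ X, ‖p - w‖ ≤ ‖y - w‖) {y : E} (hy : y ∈ X) :
    ‖p - y‖ ^ 2 ≤ ‖w - y‖ ^ 2 := by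
  have h := inner_sub_nearest_point_nonpos hconv hp hmin hy
  have e : w - y = (w - p) - (y - p) := by abel
  rw [norm_sub_rev p y, e, norm_sub_sq_real (w - p)]
  nlinarith [sq_nonneg ‖w - p‖]

/-- A unit vector supporting a sublevel set of a Lipschitz function at `p` separates `p` from
every point `q` of that set by at least `(f p - f q) / L`. -/
lemma inner_le_of_supports_sublevel {E : Type*} [NormedAddCommGroup E]
    [InnerProductSpace ℝ E] {L : ℝ} (hL : 0 < L) {f : E → ℝ}
    (hf : ∀ z w : E, |f z - f w| ≤ L * ‖z - w‖) {u p q : E} (hu : ‖u‖ = 1)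
    (hsupp : ∀ z : E, f z ≤ f p → ⟪u, z - p⟫ ≤ 0) (hq : f q ≤ f p) :
    ⟪u, q - p⟫ ≤ -((f p - f q) / L) := by
  have hg : 0 ≤ (f p - f q) / L := div_nonneg (sub_nonneg.2 hq) hL.le
  have hz : f (q + ((f p - f q) / L) • u) ≤ f p := by
    have h := (le_abs_self _).trans (hf (q + ((f p - f q) / L) • u) q)
    rw [add_sub_cancel_left, norm_smul, hu, Real.norm_of_nonneg hg, mul_one,
      mul_div_cancel₀ _ hL.ne'] at h
    linarith
  have h := hsupp _ hz
  rw [add_sub_right_comm, inner_add_right, real_inner_smul_right,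
    real_inner_self_eq_norm_sq, hu] at h
  linarith

/-- The decrease of the squared distance to a point `q ∈ X` in one projected subgradient step. -/
lemma projected_subgradient_step {E : Type*} [NormedAddCommGroup E]
    [InnerProductSpace ℝ E] {X : Set E} (hconv : Convex ℝ X) {L ε : ℝ} (hL : 0 < L)
    (hε : 0 ≤ ε) {f : E → ℝ} (hf : ∀ z w : E, |f z - f w| ≤ L * ‖z - w‖) {u p p' q : E}
    (hu : ‖u‖ = 1) (hsupp : ∀ z : E, f z ≤ f p → ⟪u, z - p⟫ ≤ 0) (hp' : p' ∈ X)
    (hmin : ∀ y ∈ X, ‖p' - (p - ε • u)‖ ≤ ‖y - (p - ε • u)‖) (hqX : q ∈ X)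
    (hq : f q ≤ f p) :
    2 * ε * ((f p - f q) / L) ≤ ‖p - q‖ ^ 2 - ‖p' - q‖ ^ 2 + ε ^ 2 := by
  have h₁ := norm_nearest_point_sub_sq_le hconv hp' hmin hqX
  have h₂ := inner_le_of_supports_sublevel hL hf hu hsupp hq
  have e : p - ε • u - q = -((q - p) + ε • u) := by abel
  rw [e, norm_neg, norm_add_sq_real, real_inner_smul_right, norm_smul, hu, mul_one,
    Real.norm_of_nonneg hε, real_inner_comm, norm_sub_rev q p] at h₁
  nlinarith [mul_le_mul_of_nonneg_left h₂ hε]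

/-- Hilbert-space case of the main complexity theorem: the projected subgradient
iteration with step length `ε = D/√n` satisfies
`(1/n) ∑_{i<n} f (x i) ≤ f x* + L D / √n`. -/
theorem projected_subgradient_complexity {E : Type*} [NormedAddCommGroup E]
    [InnerProductSpace ℝ E] [CompleteSpace E]
    (X : Set E) (hne : X.Nonempty) (hcl : IsClosed X) (hconv : Convex ℝ X)
    (D : ℝ) (hD : 0 < D) (hdiam : ∀ p ∈ X, ∀ q ∈ X, dist p q ≤ D)
    (L : ℝ) (hL : 0 < L) (f : E → ℝ) (hf : ∀ z w : E, |f z - f w| ≤ L * ‖z - w‖)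
    (xstar : E) (hxstar : xstar ∈ X) (hmin : ∀ y ∈ X, f xstar ≤ f y)
    (n : ℕ) (hn : 0 < n) (ε : ℝ) (hε : ε = D / Real.sqrt n)
    (x : ℕ → E) (hx0 : x 0 ∈ X) (u : ℕ → E)
    (hu : ∀ i < n, ‖u i‖ = 1)
    (hsupp : ∀ i < n, ∀ z : E, f z ≤ f (x i) → ⟪u i, z - x i⟫ ≤ 0)
    (hproj : ∀ i < n, x (i + 1) ∈ X ∧
      ∀ y ∈ X, ‖x (i + 1) - (x i - ε • u i)‖ ≤ ‖y - (x i - ε • u i)‖) :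
    (1 / (n : ℝ)) * ∑ i ∈ Finset.range n, f (x i)
      ≤ f xstar + L * D / Real.sqrt n := by
  have hn' : (0 : ℝ) < n := Nat.cast_pos.2 hn
  have hs : 0 < Real.sqrt n := Real.sqrt_pos.2 hn'
  have hss : Real.sqrt n ^ 2 = n := Real.sq_sqrt hn'.le
  have hε₀ : 0 < ε := hε ▸ div_pos hD hs
  have hmem : ∀ i ≤ n, x i ∈ X := by
    rintro (_ | i) hi
    · exact hx0
    · exact (hproj i hi).1
  have hsum := Finset.sum_le_sum fun i (hi : i ∈ Finset.range n) =>
    have hi := Finset.mem_range.1 hi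
    projected_subgradient_step hconv hL hε₀.le hf (hu i hi) (hsupp i hi) (hproj i hi).1
      (hproj i hi).2 hxstar (hmin _ (hmem i hi.le))
  rw [Finset.sum_add_distrib, Finset.sum_range_sub' fun i => ‖x i - xstar‖ ^ 2,
    ← Finset.mul_sum, ← Finset.sum_div, Finset.sum_sub_distrib] at hsum
  simp only [Finset.sum_const, Finset.card_range, nsmul_eq_mul] at hsum
  have hD₀ : ‖x 0 - xstar‖ ^ 2 ≤ D ^ 2 :=
    pow_le_pow_left₀ (norm_nonneg _) (dist_eq_norm (x 0) xstar ▸ hdiam _ hx0 _ hxstar) 2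
  have hDε : D = ε * Real.sqrt n := by rw [hε, div_mul_cancel₀ _ hs.ne']
  set S := ∑ i ∈ Finset.range n, f (x i)
  have hgap : (S - n * f xstar) / L ≤ ε * n := by
    have hD₂ : D ^ 2 = ε * (ε * n) := by rw [hDε, mul_pow, hss]; ring
    refine le_of_mul_le_mul_left ?_ hε₀
    nlinarith [sq_nonneg ‖x n - xstar‖]
  rw [div_le_iff₀ hL] at hgap
  rw [mul_div_assoc, ← hε, one_div_mul_eq_div, div_le_iff₀ hn']
  linarith
end

section
/- (Hilbert-space circumcenter complexity.) Let E be a real Hilbert space and A ⊆ E a nonempty finite set of diameter at most μ, with μ > 0, and let σ = ⨅_{x ∈ E} max_{a ∈ A} dist(x, a) be the circumradius of A. Fix an integer n ≥ 16, pick x 0 ∈ A, set ρ = max_{a ∈ A} dist(x 0, a), assume ρ > 0, and set ε = 2ρ/√n. Define iterates by: for each k < n, let â k ∈ A attain max_{a ∈ A} dist(x k, a), and set x (k+1) = x k + (ε / dist(x k, â k)) • (â k − x k) (this is well defined since max_{a ∈ A} dist(x k, a) ≥ ρ/2 ≥ ε > 0). Then there exists k < n with dist(x k, a) ≤ σ +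 2μ/√n for every a ∈ A; i.e., some iterate's distance to every point of A exceeds the circumradius by at most 2μ/√n. -/
/-- One step of length `ε` from `x` toward `a` decreases the squared distance to `y`
by at least `2 * ε * (dist x a - dist y a) - ε ^ 2`. -/
lemma dist_sq_add_smul_sub_le {E : Type*} [NormedAddCommGroup E] [InnerProductSpace ℝ E]
    {x a : E} (hxa : 0 < dist x a) (y : E) {ε : ℝ} (hε : 0 ≤ ε) :
    dist (x + (ε / dist x a) • (a - x)) y ^ 2 ≤
      dist x y ^ 2 - 2 * ε * (dist x a - dist y a) + ε ^ 2 := by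
  set d := dist x a with hd
  have hnorm : ‖a - x‖ = d := by rw [hd, dist_comm, dist_eq_norm]
  have hsplit : inner ℝ (x - y) (a - x) = inner ℝ (a - y) (a - x) - d ^ 2 := by
    rw [← hnorm, ← real_inner_self_eq_norm_sq, ← inner_sub_left]
    congr 1
    abel
  have hinner : inner ℝ (a - y) (a - x) ≤ dist y a * d := by
    rw [← hnorm, dist_comm y a, dist_eq_norm a y]
    exact real_inner_le_norm _ _
  have hexpand : dist (x + (ε / d) • (a - x)) y ^ 2 =
      dist x y ^ 2 + 2 * (ε / d) * inner ℝ (x - y) (a - x) + ε ^ 2 := by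
    rw [dist_eq_norm, dist_eq_norm, add_sub_right_comm, norm_add_sq_real, inner_smul_right,
      norm_smul, hnorm, Real.norm_of_nonneg (by positivity), div_mul_cancel₀ _ hxa.ne']
    ring
  have hbound : ε / d * inner ℝ (x - y) (a - x) ≤ ε / d * (dist y a * d - d ^ 2) := by
    rw [hsplit]
    gcongr
  have hcancel : ε / d * (dist y a * d - d ^ 2) = ε * (dist y a - d) := by
    field_simp
  rw [hexpand]
  linarith


/-- Hilbert-space circumcenter complexity: after `n ≥ 16` steps of the
subgradient iteration for the minimal enclosing ball problem (moving distance
`ε = 2ρ/√n` toward a farthest point of `A` at each step), some iterate's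
distance to every point of `A` exceeds the circumradius `σ` by at most
`2μ/√n`, where `μ` bounds the diameter of `A`. -/
theorem circumcenter_subgradient_complexity {E : Type*} [NormedAddCommGroup E]
    [InnerProductSpace ℝ E] [CompleteSpace E]
    (A : Finset E) (hA : A.Nonempty) (μ : ℝ) (hμ : 0 < μ)
    (hdiam : ∀ a ∈ A, ∀ b ∈ A, dist a b ≤ μ)
    (σ : ℝ) (hσ : σ = ⨅ x : E, A.sup' hA (fun a => dist x a))
    (n : ℕ) (hn : 16 ≤ n)
    (x : ℕ → E) (hx0 : x 0 ∈ A)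
    (ρ : ℝ) (hρ : ρ = A.sup' hA (fun a => dist (x 0) a)) (hρpos : 0 < ρ)
    (ε : ℝ) (hε : ε = 2 * ρ / Real.sqrt n)
    (ahat : ℕ → E)
    (hahat : ∀ k < n, ahat k ∈ A ∧
      dist (x k) (ahat k) = A.sup' hA (fun a => dist (x k) a))
    (hiter : ∀ k < n, x (k + 1) = x k + (ε / dist (x k) (ahat k)) • (ahat k - x k)) :
    ∃ k < n, ∀ a ∈ A, dist (x k) a ≤ σ + 2 * μ / Real.sqrt n := by
  by_contra! hcon
  set f : E → ℝ := fun y => A.sup' hA (fun a => dist y a) with hf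
  have hle : ∀ y, ∀ a ∈ A, dist y a ≤ f y := fun y a ha =>
    Finset.le_sup' (fun a => dist y a) ha
  have hf0 : ∀ y, 0 ≤ f y := fun y => dist_nonneg.trans (hle y _ hx0)
  have hσ0 : 0 ≤ σ := hσ ▸ Real.iInf_nonneg hf0
  have hσρ : σ ≤ ρ := by
    rw [hσ, hρ]
    exact ciInf_le ⟨0, by rintro _ ⟨y, rfl⟩; exact hf0 y⟩ (x 0)
  have hρμ : ρ ≤ μ := hρ ▸ Finset.sup'_le _ _ fun a ha => hdiam _ hx0 a ha
  set s := Real.sqrt n with hs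
  have hn' : (16 : ℝ) ≤ n := by exact_mod_cast hn
  have hs4 : 4 ≤ s := Real.le_sqrt_of_sq_le (by linarith)
  have hss : s ^ 2 = n := Real.sq_sqrt (by linarith)
  obtain ⟨r, hr⟩ : ∃ r, r = ρ / s := ⟨_, rfl⟩
  have hrpos : 0 < r := by rw [hr]; positivity
  have hrs : r * s = ρ := by rw [hr]; field_simp
  have hεr : ε = 2 * r := by rw [hε, hr]; ring
  have hμr : 2 * r ≤ 2 * μ / s := by
    rw [hr, ← mul_div_assoc]
    gcongr
  obtain ⟨y, hy⟩ : ∃ y, f y < σ + r / 4 := by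
    apply exists_lt_of_ciInf_lt
    rw [← hσ]
    linarith
  have hstep : ∀ k < n, dist (x (k + 1)) y ^ 2 ≤ dist (x k) y ^ 2 - 3 * r ^ 2 := by
    intro k hk
    obtain ⟨a, ha, hlt⟩ := hcon k hk
    have hfar : σ + 2 * μ / s < dist (x k) (ahat k) :=
      hlt.trans_le ((hle _ a ha).trans_eq (hahat k hk).2.symm)
    have hdescent := dist_sq_add_smul_sub_le (x := x k) (a := ahat k) (by linarith) y
      (ε := ε) (by linarith)
    rw [← hiter k hk, hεr] at hdescent
    have := hle y _ (hahat k hk).1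
    nlinarith
  have hsum : ∀ k ≤ n, dist (x k) y ^ 2 ≤ dist (x 0) y ^ 2 - k * (3 * r ^ 2) := by
    intro k
    induction k with
    | zero => simp
    | succ k ih =>
      intro hk
      have := ih (by omega)
      have := hstep k hk
      push_cast
      linarith
  have hfinal := hsum n le_rfl
  have hstart : dist (x 0) y ≤ ρ + r / 4 := by
    rw [dist_comm]
    linarith [hle y _ hx0]
  have hnr : n * (3 * r ^ 2) = 3 * ρ ^ 2 := by
    rw [← hss, ← hrs]
    ring
  have hrρ : 4 * r ≤ ρ := by nlinarith
  have hstart' : dist (x 0) y ≤ 17 / 16 * ρ := by linarith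
  nlinarith [sq_nonneg (dist (x n) y), dist_nonneg (x := x 0) (y := y)]
end

section
/- Let T be the tripod: the metric space obtained from three copies of ℝ≥0 (legs indexed by i ∈ {0,1,2}) glued at 0, with distance |s − t| between points (i,s), (i,t) on the same leg and s + t between points (i,s), (j,t) on different legs (i ≠ j). Let a, b, c > 0 and let p₀ = (0,a), p₁ = (1,b), p₂ = (2,c), and let o denote the glue point. If a + b > c, b + c > a, and c + a > b, then o is the unique minimizer over T of the Fréchet-mean objective x ↦ dist(x,p₀)² + dist(x,p₁)² + dist(x,p₂)². -/
/-- The tripod distance on three legs (copies of `ℝ≥0`, indexed by `Fin 3`,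
glued at `0`): points on the same leg are at distance `|s - t|`, points on
different legs at distance `s + t`.  (On points with nonnegative second
coordinate, all points `(i, 0)` are at mutual distance `0`: they represent the
single glue point `o`.) -/
noncomputable def tripodDist (p q : Fin 3 × ℝ) : ℝ :=
  if p.1 = q.1 then |p.2 - q.2| else p.2 + q.2

/-- Stickiness of the Fréchet mean in the tripod: if `a, b, c > 0` satisfy the
strict triangle inequalities, then the glue point `o` is the unique minimizer
of the sum of squared distances to the three points `(0,a), (1,b), (2,c)`
(uniqueness: every point of the tripod other than `o`, i.e. with positive
coordinate, has strictly larger objective value). -/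
theorem tripod_frechetMean_sticky (a b c : ℝ) (ha : 0 < a) (hb : 0 < b) (hc : 0 < c)
    (hab : a + b > c) (hbc : b + c > a) (hca : c + a > b) :
    (∀ x : Fin 3 × ℝ, 0 ≤ x.2 →
      tripodDist ((0 : Fin 3), (0 : ℝ)) ((0 : Fin 3), a) ^ 2
        + tripodDist ((0 : Fin 3), (0 : ℝ)) ((1 : Fin 3), b) ^ 2
        + tripodDist ((0 : Fin 3), (0 : ℝ)) ((2 : Fin 3), c) ^ 2
      ≤ tripodDist x ((0 : Fin 3), a) ^ 2 + tripodDist x ((1 : Fin 3), b) ^ 2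
        + tripodDist x ((2 : Fin 3), c) ^ 2) ∧
    (∀ x : Fin 3 × ℝ, 0 < x.2 →
      tripodDist ((0 : Fin 3), (0 : ℝ)) ((0 : Fin 3), a) ^ 2
        + tripodDist ((0 : Fin 3), (0 : ℝ)) ((1 : Fin 3), b) ^ 2
        + tripodDist ((0 : Fin 3), (0 : ℝ)) ((2 : Fin 3), c) ^ 2
      < tripodDist x ((0 : Fin 3), a) ^ 2 + tripodDist x ((1 : Fin 3), b) ^ 2
        + tripodDist x ((2 : Fin 3), c) ^ 2) := by
  have strict : ∀ x : Fin 3 × ℝ, 0 < x.2 →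
      tripodDist ((0 : Fin 3), (0 : ℝ)) ((0 : Fin 3), a) ^ 2
        + tripodDist ((0 : Fin 3), (0 : ℝ)) ((1 : Fin 3), b) ^ 2
        + tripodDist ((0 : Fin 3), (0 : ℝ)) ((2 : Fin 3), c) ^ 2
      < tripodDist x ((0 : Fin 3), a) ^ 2 + tripodDist x ((1 : Fin 3), b) ^ 2
        + tripodDist x ((2 : Fin 3), c) ^ 2 := by
    rintro ⟨i, s⟩ hs
    replace hs : 0 < s := hs
    have h₀ := mul_pos hs (sub_pos.2 hbc)
    have h₁ := mul_pos hs (sub_pos.2 hca)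
    have h₂ := mul_pos hs (sub_pos.2 hab)
    have hss := mul_pos hs hs
    fin_cases i <;> simp [tripodDist] <;> nlinarith
  refine ⟨fun x hx => ?_, strict⟩
  rcases hx.lt_or_eq with h | h
  · exact (strict x h).le
  · obtain ⟨i, s⟩ := x
    obtain rfl : 0 = s := h
    fin_cases i <;> simp [tripodDist]
end

section
/- Let T be the tripod: the metric space obtained from three copies of ℝ≥0 (legs indexed by i ∈ {0,1,2}) glued at 0, with distance |s − t| between points (i,s), (i,t) on the same leg and s + t between points (i,s), (j,t) on different legs (i ≠ j). Let a, b, c > 0 and let p₀ = (0,a), p₁ = (1,b), p₂ = (2,c), and let o denote the glue point. Then o is a minimizer over T of the circumcenter objective x ↦ max(dist(x,p₀), dist(x,p₁), dist(x,p₂)) if and only if the maximum of (a, b, c) is not uniquely attained, i.e. at least two of a, b, c equal max(a,b,c). -/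
/-- If no point on the leg of a point at height `a` improves on the glue point, then `a` does not
exceed the largest height `m` on the other legs. -/
lemma le_of_forall_le_max_abs_sub_add {a m : ℝ} (hm : 0 < m)
    (h : ∀ t : ℝ, 0 ≤ t → a ≤ max |t - a| (t + m)) : a ≤ m := by
  by_contra! hlt
  have hmid := h ((a - m) / 2) (by linarith)
  rw [abs_of_nonpos (by linarith)] at hmid
  rcases le_max_iff.mp hmid with h' | h' <;> linarith

/-- In the tripod, the glue point `o` is a minimizer of the circumcenter
objective `x ↦ max (dist x (0,a)) (max (dist x (1,b)) (dist x (2,c)))` iff the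
maximum of `(a, b, c)` is attained at least twice. -/
theorem tripod_circumcenter_iff (a b c : ℝ) (ha : 0 < a) (hb : 0 < b) (hc : 0 < c) :
    (∀ x : Fin 3 × ℝ, 0 ≤ x.2 →
      max (tripodDist ((0 : Fin 3), (0 : ℝ)) ((0 : Fin 3), a))
        (max (tripodDist ((0 : Fin 3), (0 : ℝ)) ((1 : Fin 3), b))
          (tripodDist ((0 : Fin 3), (0 : ℝ)) ((2 : Fin 3), c)))
      ≤ max (tripodDist x ((0 : Fin 3), a))
          (max (tripodDist x ((1 : Fin 3), b)) (tripodDist x ((2 : Fin 3), c)))) ↔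
    ((a = max a (max b c) ∧ b = max a (max b c)) ∨
     (b = max a (max b c) ∧ c = max a (max b c)) ∨
     (a = max a (max b c) ∧ c = max a (max b c))) := by
  constructor
  · intro h
    have h₀ : a ≤ max b c := by
      refine le_of_forall_le_max_abs_sub_add (lt_max_of_lt_left hb) fun t ht => ?_
      have := h (0, t) ht
      simp only [tripodDist] at this
      grind
    have h₁ : b ≤ max a c := by
      refine le_of_forall_le_max_abs_sub_add (lt_max_of_lt_left ha) fun t ht => ?_
      have := h (1, t) ht
      simp only [tripodDist] at this
      grind
    have h₂ : c ≤ max a b := by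
      refine le_of_forall_le_max_abs_sub_add (lt_max_of_lt_left ha) fun t ht => ?_
      have := h (2, t) ht
      simp only [tripodDist] at this
      grind
    grind
  · rintro h ⟨i, t⟩ ht
    simp only [tripodDist] at ht ⊢
    fin_cases i <;> grind
end
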